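/- If f : ℝⁿ → ℝ is L-smooth, then for every x ∈ ℝⁿ, E_{u ~ N(0,I)}[‖((f(x + μu) - f(x))/μ) u‖²] ≤ 2(n+4)‖∇f(x)‖² + (μ²/2) L² (n+6)³. -/

import Mathlib

open MeasureTheory

/-- The standard Gaussian measure `N(0, I)` on `ℝⁿ`. -/
noncomputable def stdGaussian (n : ℕ) : Measure (EuclideanSpace ℝ (Fin n)) :=
  (Measure.pi fun _ : Fin n => ProbabilityTheory.gaussianReal 0 1).map
    (EuclideanSpace.equiv (Fin n) ℝ).symm

/-- Gaussian smoothing `fᵘ(x) = E_{u ~ N(0,I)}[f(x + μ u)]`. -/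
noncomputable def gaussianSmoothing {n : ℕ} (f : EuclideanSpace ℝ (Fin n) → ℝ) (μ : ℝ) :
    EuclideanSpace ℝ (Fin n) → ℝ :=
  fun x => ∫ u, f (x + μ • u) ∂(stdGaussian n)

/-- First-order Taylor estimate for a function with Lipschitz gradient. -/
theorem abs_sub_sub_inner_gradient_le {E : Type*} [NormedAddCommGroup E] [InnerProductSpace ℝ E]
    [CompleteSpace E] {f : E → ℝ} {L : ℝ} (hdiff : ∀ x, DifferentiableAt ℝ f x)
    (hf : ∀ x y, ‖gradient f x - gradient f y‖ ≤ L * ‖x - y‖) (x v : E) :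
    |f (x + v) - f x - inner ℝ (gradient f x) v| ≤ L / 2 * ‖v‖ ^ 2 := by
  have hline (t : ℝ) : HasDerivAt (fun s : ℝ => x + s • v) v t := by
    simpa using ((hasDerivAt_id t).smul_const v).const_add x
  have hderiv (t : ℝ) : HasDerivAt
      (fun s : ℝ => f (x + s • v) - f x - s * inner ℝ (gradient f x) v)
      (inner ℝ (gradient f (x + t • v) - gradient f x) v) t := by
    have h₁ := (hdiff (x + t • v)).hasGradientAt.hasFDerivAt.comp_hasDerivAt t (hline t)
    have h₂ := (h₁.sub_const (f x)).fun_sub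
      ((hasDerivAt_id t).mul_const (inner ℝ (gradient f x) v))
    simpa [inner_sub_left, Function.comp_def] using h₂
  have hB (t : ℝ) : HasDerivAt (fun s : ℝ => L / 2 * ‖v‖ ^ 2 * s ^ 2) (L * t * ‖v‖ ^ 2) t := by
    convert! (hasDerivAt_pow 2 t).const_mul (L / 2 * ‖v‖ ^ 2) using 1
    norm_num
    ring
  have key := image_norm_le_of_norm_deriv_right_le_deriv_boundary (a := 0) (b := 1)
    (fun t _ => (hderiv t).continuousAt.continuousWithinAt)
    (fun t _ => (hderiv t).hasDerivWithinAt) (by simp) hB (fun t ht => by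
      calc ‖inner ℝ (gradient f (x + t • v) - gradient f x) v‖
          ≤ ‖gradient f (x + t • v) - gradient f x‖ * ‖v‖ := norm_inner_le_norm _ _
        _ ≤ L * ‖x + t • v - x‖ * ‖v‖ := by gcongr; exact hf _ _
        _ = L * t * ‖v‖ ^ 2 := by
          rw [add_sub_cancel_left, norm_smul, Real.norm_of_nonneg ht.1]
          ring) (Set.right_mem_Icc.2 zero_le_one)
  simpa using key

theorem integrable_pow_mul_exp_neg_half_sq (k : ℕ) :
    Integrable fun x : ℝ => x ^ k * Real.exp (-(1 / 2) * x ^ 2) := by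
  have h := integrable_rpow_mul_exp_neg_mul_sq (b := 1 / 2) (by norm_num) (s := (k : ℝ))
    (by have := k.cast_nonneg (α := ℝ); linarith)
  simpa only [Real.rpow_natCast] using h

/-- Integration by parts against the Gaussian weight. -/
theorem integral_pow_add_two_mul_exp_neg_half_sq (k : ℕ) :
    ∫ x : ℝ, x ^ (k + 2) * Real.exp (-(1 / 2) * x ^ 2) =
      (k + 1) * ∫ x : ℝ, x ^ k * Real.exp (-(1 / 2) * x ^ 2) := by
  have hu (x : ℝ) : HasDerivAt (fun y : ℝ => y ^ (k + 1)) ((k + 1) * x ^ k) x := by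
    simpa using hasDerivAt_pow (k + 1) x
  have hv (x : ℝ) : HasDerivAt (fun y : ℝ => Real.exp (-(1 / 2) * y ^ 2))
      (-(x * Real.exp (-(1 / 2) * x ^ 2))) x := by
    convert! ((hasDerivAt_pow 2 x).const_mul (-(1 / 2))).exp using 1
    norm_num
    ring
  have h := integral_mul_deriv_eq_deriv_mul_of_integrable (fun x _ => hu x) (fun x _ => hv x)
    ((integrable_pow_mul_exp_neg_half_sq (k + 2)).neg.congr
      (.of_forall fun x => by simp only [Pi.neg_apply, Pi.mul_apply]; ring))
    (((integrable_pow_mul_exp_neg_half_sq k).const_mul (k + 1)).congr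
      (.of_forall fun x => by simp only [Pi.mul_apply]; ring))
    (integrable_pow_mul_exp_neg_half_sq (k + 1))
  rw [← integral_const_mul, ← neg_inj, ← integral_neg]
  calc _ = ∫ x : ℝ, x ^ (k + 1) * -(x * Real.exp (-(1 / 2) * x ^ 2)) := by
        refine integral_congr_ae (.of_forall fun x => ?_)
        ring
    _ = _ := by
        rw [h]
        simp only [mul_assoc]

theorem integral_gaussianReal_zero_one (g : ℝ → ℝ) :
    ∫ x, g x ∂(ProbabilityTheory.gaussianReal 0 1) =
      (√(2 * Real.pi))⁻¹ * ∫ x, g x * Real.exp (-(1 / 2) * x ^ 2) := by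
  rw [ProbabilityTheory.integral_gaussianReal_eq_integral_smul one_ne_zero,
    ← integral_const_mul]
  congr 1
  ext x
  rw [ProbabilityTheory.gaussianPDFReal_def]
  simp only [NNReal.coe_one, mul_one, sub_zero, smul_eq_mul]
  rw [show -x ^ 2 / 2 = -(1 / 2) * x ^ 2 by ring]
  ring

theorem integral_pow_four_gaussianReal :
    ∫ x, x ^ 4 ∂(ProbabilityTheory.gaussianReal 0 1) = 3 := by
  have h₀ := integral_gaussian (1 / 2)
  have h₂ := integral_pow_add_two_mul_exp_neg_half_sq 0
  have h₄ := integral_pow_add_two_mul_exp_neg_half_sq 2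
  simp only [pow_zero, one_mul] at h₂
  rw [integral_gaussianReal_zero_one, h₄, h₂, h₀, show Real.pi / (1 / 2) = 2 * Real.pi by ring]
  have : √(2 * Real.pi) ≠ 0 := by positivity
  field_simp
  norm_num

theorem integrable_exp_mul_sq_gaussianReal {t : ℝ} (ht : t < 1 / 2) :
    Integrable (fun x => Real.exp (t * x ^ 2)) (ProbabilityTheory.gaussianReal 0 1) := by
  rw [ProbabilityTheory.gaussianReal_of_var_ne_zero _ one_ne_zero,
    integrable_withDensity_iff_integrable_smul' (ProbabilityTheory.measurable_gaussianPDF _ _)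
      (.of_forall fun _ => ProbabilityTheory.gaussianPDF_lt_top)]
  refine ((integrable_exp_neg_mul_sq (b := 1 / 2 - t) (by linarith)).const_mul
    (√(2 * Real.pi))⁻¹).congr (.of_forall fun x => ?_)
  simp only [ProbabilityTheory.toReal_gaussianPDF, ProbabilityTheory.gaussianPDFReal_def,
    NNReal.coe_one, mul_one, sub_zero, smul_eq_mul, mul_assoc, ← Real.exp_add]
  ring_nf

theorem integral_exp_mul_sq_gaussianReal {t : ℝ} (ht : t < 1 / 2) :
    ∫ x, Real.exp (t * x ^ 2) ∂(ProbabilityTheory.gaussianReal 0 1) = √(1 / (1 - 2 * t)) := by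
  rw [integral_gaussianReal_zero_one]
  have h : ∀ x : ℝ, Real.exp (t * x ^ 2) * Real.exp (-(1 / 2) * x ^ 2) =
      Real.exp (-(1 / 2 - t) * x ^ 2) := fun x => by rw [← Real.exp_add]; ring_nf
  simp_rw [h]
  rw [integral_gaussian, ← Real.sqrt_inv, ← Real.sqrt_mul (by positivity)]
  congr 1
  have : 1 - 2 * t ≠ 0 := by linarith
  have : 1 / 2 - t ≠ 0 := by linarith
  field_simp

theorem stdGaussian_eq (n : ℕ) :
    stdGaussian n = ProbabilityTheory.stdGaussian (EuclideanSpace ℝ (Fin n)) :=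
  ProbabilityTheory.map_pi_eq_stdGaussian

instance isGaussian_stdGaussian (n : ℕ) : ProbabilityTheory.IsGaussian (stdGaussian n) := by
  rw [stdGaussian_eq]
  infer_instance

theorem map_inner_stdGaussian {n : ℕ} (a : EuclideanSpace ℝ (Fin n)) :
    (stdGaussian n).map (fun u => inner ℝ a u) =
      (ProbabilityTheory.gaussianReal 0 1).map (fun x => ‖a‖ * x) := by
  rw [stdGaussian_eq, ProbabilityTheory.gaussianReal_map_const_mul]
  have h := ProbabilityTheory.IsGaussian.map_eq_gaussianReal
    (μ := ProbabilityTheory.stdGaussian (EuclideanSpace ℝ (Fin n))) (innerSL ℝ a)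
  rw [ProbabilityTheory.integral_strongDual_stdGaussian,
    ProbabilityTheory.variance_dual_stdGaussian, innerSL_apply_norm] at h
  convert! h using 2
  · simp
  · ext; simp

theorem integral_inner_pow_four_stdGaussian {n : ℕ} (a : EuclideanSpace ℝ (Fin n)) :
    ∫ u, inner ℝ a u ^ 4 ∂(stdGaussian n) = 3 * ‖a‖ ^ 4 := by
  rw [← integral_map (φ := fun u => inner ℝ a u) (f := fun x : ℝ => x ^ 4) (by fun_prop)
    (by fun_prop), map_inner_stdGaussian, integral_map (by fun_prop) (by fun_prop)]
  simp_rw [mul_pow]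
  rw [integral_const_mul, integral_pow_four_gaussianReal, mul_comm]

theorem integrable_norm_pow_stdGaussian (n k : ℕ) :
    Integrable (fun u => ‖u‖ ^ k) (stdGaussian n) :=
  (ProbabilityTheory.IsGaussian.memLp_id (stdGaussian n) k (by simp)).integrable_norm_pow'

theorem integrable_inner_sq_mul_inner_sq_stdGaussian {n : ℕ} (a b : EuclideanSpace ℝ (Fin n)) :
    Integrable (fun u => inner ℝ a u ^ 2 * inner ℝ b u ^ 2) (stdGaussian n) := by
  refine ((integrable_norm_pow_stdGaussian n 4).const_mul (‖a‖ ^ 2 * ‖b‖ ^ 2)).mono'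
    (by fun_prop) (.of_forall fun u => ?_)
  rw [norm_mul, norm_pow, norm_pow]
  calc ‖inner ℝ a u‖ ^ 2 * ‖inner ℝ b u‖ ^ 2 ≤ (‖a‖ * ‖u‖) ^ 2 * (‖b‖ * ‖u‖) ^ 2 := by
        gcongr <;> exact norm_inner_le_norm _ _
    _ = _ := by ring

theorem integrable_inner_pow_four_stdGaussian {n : ℕ} (a : EuclideanSpace ℝ (Fin n)) :
    Integrable (fun u => inner ℝ a u ^ 4) (stdGaussian n) := by
  simpa only [← pow_add] using integrable_inner_sq_mul_inner_sq_stdGaussian a a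

/-- A case of Isserlis' theorem, by polarization of the fourth moment. -/
theorem integral_inner_sq_mul_inner_sq_stdGaussian {n : ℕ} (a b : EuclideanSpace ℝ (Fin n)) :
    ∫ u, inner ℝ a u ^ 2 * inner ℝ b u ^ 2 ∂(stdGaussian n) =
      ‖a‖ ^ 2 * ‖b‖ ^ 2 + 2 * inner ℝ a b ^ 2 := by
  have hpol (u : EuclideanSpace ℝ (Fin n)) : inner ℝ (a + b) u ^ 4 + inner ℝ (a - b) u ^ 4 =
      12 * (inner ℝ a u ^ 2 * inner ℝ b u ^ 2) + 2 * inner ℝ a u ^ 4 + 2 * inner ℝ b u ^ 4 := by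
    rw [inner_add_left, inner_sub_left]
    ring
  have h := integral_congr_ae (μ := stdGaussian n) (.of_forall hpol)
  have hab := integrable_inner_sq_mul_inner_sq_stdGaussian a b
  have ha := integrable_inner_pow_four_stdGaussian a
  have hb := integrable_inner_pow_four_stdGaussian b
  rw [integral_add (integrable_inner_pow_four_stdGaussian _)
      (integrable_inner_pow_four_stdGaussian _),
    integral_add ((hab.const_mul _).fun_add (ha.const_mul _)) (hb.const_mul _),
    integral_add (hab.const_mul _) (ha.const_mul _)] at h
  simp only [integral_const_mul, integral_inner_pow_four_stdGaussian] at h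
  have hadd : ‖a + b‖ ^ 4 = (‖a‖ ^ 2 + 2 * inner ℝ a b + ‖b‖ ^ 2) ^ 2 := by
    rw [← norm_add_sq_real]; ring
  have hsub : ‖a - b‖ ^ 4 = (‖a‖ ^ 2 - 2 * inner ℝ a b + ‖b‖ ^ 2) ^ 2 := by
    rw [← norm_sub_sq_real]; ring
  rw [hadd, hsub] at h
  linarith

theorem inner_sq_mul_norm_sq_eq_sum {n : ℕ} (g u : EuclideanSpace ℝ (Fin n)) :
    inner ℝ g u ^ 2 * ‖u‖ ^ 2 =
      ∑ i, inner ℝ g u ^ 2 * inner ℝ (EuclideanSpace.basisFun (Fin n) ℝ i) u ^ 2 := by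
  rw [← Finset.mul_sum, OrthonormalBasis.sum_sq_inner_right]

theorem integrable_inner_sq_mul_norm_sq_stdGaussian {n : ℕ} (g : EuclideanSpace ℝ (Fin n)) :
    Integrable (fun u => inner ℝ g u ^ 2 * ‖u‖ ^ 2) (stdGaussian n) := by
  simp_rw [inner_sq_mul_norm_sq_eq_sum]
  exact integrable_finsetSum _ fun i _ => integrable_inner_sq_mul_inner_sq_stdGaussian _ _

theorem integral_inner_sq_mul_norm_sq_stdGaussian {n : ℕ} (g : EuclideanSpace ℝ (Fin n)) :
    ∫ u, inner ℝ g u ^ 2 * ‖u‖ ^ 2 ∂(stdGaussian n) = (n + 2) * ‖g‖ ^ 2 := by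
  simp_rw [inner_sq_mul_norm_sq_eq_sum]
  rw [integral_finsetSum _ fun i _ => integrable_inner_sq_mul_inner_sq_stdGaussian _ _]
  simp_rw [integral_inner_sq_mul_inner_sq_stdGaussian]
  rw [Finset.sum_add_distrib, ← Finset.mul_sum, ← Finset.mul_sum,
    OrthonormalBasis.sum_sq_inner_left]
  simp
  ring

theorem exp_mul_norm_sq_eq_prod {n : ℕ} (t : ℝ) (v : Fin n → ℝ) :
    Real.exp (t * ‖(EuclideanSpace.equiv (Fin n) ℝ).symm v‖ ^ 2) =
      ∏ i, Real.exp (t * v i ^ 2) := by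
  rw [EuclideanSpace.real_norm_sq_eq, Finset.mul_sum, Real.exp_sum]
  rfl

theorem integrable_exp_mul_norm_sq_stdGaussian (n : ℕ) {t : ℝ} (ht : t < 1 / 2) :
    Integrable (fun u => Real.exp (t * ‖u‖ ^ 2)) (stdGaussian n) := by
  rw [stdGaussian, integrable_map_measure (by fun_prop) (by fun_prop)]
  simp only [Function.comp_def, exp_mul_norm_sq_eq_prod]
  exact Integrable.fintype_prod fun _ => integrable_exp_mul_sq_gaussianReal ht

theorem integral_exp_mul_norm_sq_stdGaussian (n : ℕ) {t : ℝ} (ht : t < 1 / 2) :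
    ∫ u, Real.exp (t * ‖u‖ ^ 2) ∂(stdGaussian n) = √(1 / (1 - 2 * t)) ^ n := by
  rw [stdGaussian, integral_map (by fun_prop) (by fun_prop)]
  simp only [exp_mul_norm_sq_eq_prod]
  rw [integral_fintype_prod_eq_pow (fun x : ℝ => Real.exp (t * x ^ 2)),
    integral_exp_mul_sq_gaussianReal ht, Fintype.card_fin]

theorem integral_norm_pow_six_stdGaussian_le (n : ℕ) :
    ∫ u, ‖u‖ ^ 6 ∂(stdGaussian n) ≤ ((n : ℝ) + 6) ^ 3 := by
  rcases Nat.eq_zero_or_pos n with rfl | hn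
  · simp only [Subsingleton.elim _ (0 : EuclideanSpace ℝ (Fin 0))]
    norm_num
  have hn' : (0 : ℝ) < n := by exact_mod_cast hn
  set m : ℝ := n + 6 with hm
  have hm₀ : 0 < m := by positivity
  have ht : 3 / m < 1 / 2 := by rw [div_lt_div_iff₀ hm₀ two_pos]; linarith
  have hpoint (u : EuclideanSpace ℝ (Fin n)) :
      ‖u‖ ^ 6 ≤ m ^ 3 * Real.exp (-3) * Real.exp (3 / m * ‖u‖ ^ 2) := by
    have h : ‖u‖ ^ 2 / m ≤ Real.exp (‖u‖ ^ 2 / m - 1) := by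
      linarith [Real.add_one_le_exp (‖u‖ ^ 2 / m - 1)]
    calc ‖u‖ ^ 6 = m ^ 3 * (‖u‖ ^ 2 / m) ^ 3 := by field_simp
      _ ≤ m ^ 3 * Real.exp (‖u‖ ^ 2 / m - 1) ^ 3 := by gcongr
      _ = _ := by
        rw [← Real.exp_nat_mul, mul_assoc, ← Real.exp_add]
        congr 2
        push_cast
        ring
  have hsqrt : √(1 / (1 - 2 * (3 / m))) ≤ Real.exp (3 / n) := by
    have h : 1 / (1 - 2 * (3 / m)) = 6 / n + 1 := by
      have : 1 - 2 * (3 / m) = n / m := by field_simp; linarith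
      rw [this]
      field_simp
      linarith
    rw [h, Real.sqrt_le_left (Real.exp_pos _).le, ← Real.exp_nat_mul]
    calc (6 / n + 1 : ℝ) ≤ Real.exp (6 / n) := Real.add_one_le_exp _
      _ = _ := by congr 1; push_cast; ring
  calc ∫ u, ‖u‖ ^ 6 ∂(stdGaussian n)
      ≤ ∫ u, m ^ 3 * Real.exp (-3) * Real.exp (3 / m * ‖u‖ ^ 2) ∂(stdGaussian n) :=
        integral_mono (integrable_norm_pow_stdGaussian n 6)
          ((integrable_exp_mul_norm_sq_stdGaussian n ht).const_mul _) hpoint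
    _ = m ^ 3 * Real.exp (-3) * √(1 / (1 - 2 * (3 / m))) ^ n := by
        rw [integral_const_mul, integral_exp_mul_norm_sq_stdGaussian n ht]
    _ ≤ m ^ 3 * Real.exp (-3) * Real.exp (3 / n) ^ n := by gcongr
    _ = m ^ 3 := by
        rw [← Real.exp_nat_mul, mul_assoc, ← Real.exp_add, mul_div_cancel₀ _ hn'.ne']
        simp

/-- second-moment bound for the zeroth-order gradient estimator:
`E_u[‖((f(x+μu)-f(x))/μ) u‖²] ≤ 2(n+4)‖∇f(x)‖² + (μ²/2) L² (n+6)³`. -/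
theorem zeroth_order_estimator_second_moment {n : ℕ} (f : EuclideanSpace ℝ (Fin n) → ℝ)
    (L : ℝ)
    (hdiff : ∀ x, DifferentiableAt ℝ f x)
    (hf : ∀ x y, ‖gradient f x - gradient f y‖ ≤ L * ‖x - y‖)
    (μ : ℝ) (hμ : 0 < μ) :
    ∀ x, ∫ u, ‖((f (x + μ • u) - f x) / μ) • u‖ ^ 2 ∂(stdGaussian n) ≤
      2 * ((n : ℝ) + 4) * ‖gradient f x‖ ^ 2 + μ ^ 2 / 2 * L ^ 2 * ((n : ℝ) + 6) ^ 3 := by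
  intro x
  set g := gradient f x with hg
  have hpoint (u : EuclideanSpace ℝ (Fin n)) : ‖((f (x + μ • u) - f x) / μ) • u‖ ^ 2 ≤
      2 * (inner ℝ g u ^ 2 * ‖u‖ ^ 2) + μ ^ 2 / 2 * L ^ 2 * ‖u‖ ^ 6 := by
    have hT := abs_sub_sub_inner_gradient_le hdiff hf x (μ • u)
    rw [← hg, inner_smul_right, norm_smul, Real.norm_of_nonneg hμ.le] at hT
    set r := (f (x + μ • u) - f x) / μ - inner ℝ g u with hr
    have hr_abs : |r| ≤ L / 2 * μ * ‖u‖ ^ 2 := by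
      have : r = (f (x + μ • u) - f x - μ * inner ℝ g u) / μ := by rw [hr]; field_simp
      rw [this, abs_div, abs_of_pos hμ, div_le_iff₀ hμ]
      linarith
    have hr_sq : r ^ 2 ≤ (L / 2 * μ * ‖u‖ ^ 2) ^ 2 := sq_le_sq' (abs_le.1 hr_abs).1
      (abs_le.1 hr_abs).2
    have hquot : (f (x + μ • u) - f x) / μ = inner ℝ g u + r := by rw [hr]; ring
    rw [norm_smul, mul_pow, Real.norm_eq_abs, sq_abs, hquot]
    calc (inner ℝ g u + r) ^ 2 * ‖u‖ ^ 2
        ≤ (2 * (inner ℝ g u ^ 2 + (L / 2 * μ * ‖u‖ ^ 2) ^ 2)) * ‖u‖ ^ 2 := by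
          gcongr
          linarith [add_sq_le (a := inner ℝ g u) (b := r)]
      _ = _ := by ring
  have hint₁ := (integrable_inner_sq_mul_norm_sq_stdGaussian g).const_mul 2
  have hint₂ := (integrable_norm_pow_stdGaussian n 6).const_mul (μ ^ 2 / 2 * L ^ 2)
  calc ∫ u, ‖((f (x + μ • u) - f x) / μ) • u‖ ^ 2 ∂(stdGaussian n)
      ≤ ∫ u, (2 * (inner ℝ g u ^ 2 * ‖u‖ ^ 2) + μ ^ 2 / 2 * L ^ 2 * ‖u‖ ^ 6) ∂(stdGaussian n) :=
        integral_mono_of_nonneg (.of_forall fun _ => by positivity) (hint₁.add hint₂)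
          (.of_forall hpoint)
    _ = 2 * ((n + 2) * ‖g‖ ^ 2) + μ ^ 2 / 2 * L ^ 2 * ∫ u, ‖u‖ ^ 6 ∂(stdGaussian n) := by
        rw [integral_add hint₁ hint₂, integral_const_mul, integral_const_mul,
          integral_inner_sq_mul_norm_sq_stdGaussian]
    _ ≤ 2 * ((n : ℝ) + 4) * ‖g‖ ^ 2 + μ ^ 2 / 2 * L ^ 2 * ((n : ℝ) + 6) ^ 3 := by
        rw [← mul_assoc]
        gcongr
        · norm_num
        · exact integral_norm_pow_six_stdGaussian_le n
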